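/- Fix k ≥ 1, ψ ∈ [0, π/2], and t ∈ ℝ. Consider angle trees ω of height k+1 in which the root angle ω_∅ is fixed and all other angles are i.i.d. uniform on [0, π/2]; write ℙ_ψ for the law with ω_∅ = ψ and ℙ_0 for the law with ω_∅ = 0. Let ℓ(t) = {z ∈ ℂ : Re z = t} be the vertical line at abscissa t. Then: (i) ℙ_ψ(ℓ(t) ∩ 𝒯_0^{(k+1)}(ω) ≠ ∅) = ℙ_0(ℓ(t + (3/4)(1 − cos ψ)) ∩ 𝒯_0^{(k+1)}(ω) ≠ ∅); and (ii) ℙ_ψ(ℓ(t) ∩ 𝒯_1^{(k+1)}(ω) ≠ ∅) = ℙ_0(ℓ(t + (3/4)(1 − sin ψ)) ∩ 𝒯_0^{(k+1)}(ω) ≠ ∅). -/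

import Mathlib

open MeasureTheory Real Set

noncomputable section

/-- The uniform probability measure on the interval `[0, π/2]`. -/
def unif : Measure ℝ := (ENNReal.ofReal (π / 2))⁻¹ • volume.restrict (Set.Icc 0 (π / 2))

/-- An angle tree of height `n`: an angle in `ℝ` for every word over `{0,1,2,3}`
of length `< n`. -/
abbrev AngleTree (n : ℕ) := ∀ k : Fin n, (Fin k → Fin 4) → ℝ

/-- The i.i.d. measure on angle trees of height `n`, each coordinate uniform on `[0, π/2]`. -/
def treeMeasure (n : ℕ) : Measure (AngleTree n) :=
  Measure.pi fun k => Measure.pi fun _ : Fin k → Fin 4 => unif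

/-- The centre `c(ω, w)` of the disk indexed by the word `w` of length `n`. -/
def center {n : ℕ} (ω : AngleTree n) (w : Fin n → Fin 4) : ℂ :=
  ∑ k : Fin n, (3 / 4 : ℂ) * (4 : ℂ)⁻¹ ^ (k : ℕ) *
    Complex.exp (((((w k : ℕ) : ℝ) * (π / 2) -
      ω k (fun i => w (Fin.castLE k.isLt.le i)) : ℝ) : ℂ) * Complex.I)

/-- The `n`-th generation random Cantor disks `𝒟_n(ω)`. -/
def cantorDisks {n : ℕ} (ω : AngleTree n) : Set ℂ :=
  ⋃ w : Fin n → Fin 4, Metric.closedBall (center ω w) ((4 : ℝ)⁻¹ ^ n)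

/-- The orthogonal projection of `E ⊆ ℂ` onto the line `ℝ·e^{iθ}`, identified with `ℝ`. -/
def proj (θ : ℝ) (E : Set ℂ) : Set ℝ :=
  (fun z => (Complex.exp (-(θ : ℂ) * Complex.I) * z).re) '' E

/-- The length of the projection of `E` in direction `θ`. -/
def projLen (θ : ℝ) (E : Set ℂ) : ℝ := (volume (proj θ E)).toReal

/-- The part `𝒯_α^{(n)}(ω)` of `𝒟_{k+1}(ω)` consisting of the disks whose word starts
with the letter `α`. -/
def TPart {k : ℕ} (α : Fin 4) (ω : AngleTree (k + 1)) : Set ℂ :=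
  ⋃ w ∈ {w : Fin (k + 1) → Fin 4 | w 0 = α},
    Metric.closedBall (center ω w) ((4 : ℝ)⁻¹ ^ (k + 1))

/-- The law of the angle tree of height `n` in which the root angle is fixed equal to `ψ`
and all the other angles are i.i.d. uniform on `[0, π/2]`. -/
def rootedTreeMeasure (n : ℕ) (ψ : ℝ) : Measure (AngleTree n) :=
  Measure.pi fun k =>
    if (k : ℕ) = 0 then Measure.dirac (fun _ => ψ)
    else Measure.pi fun _ : Fin k → Fin 4 => unif

/-- The vertical line in the complex plane at abscissa `t`. -/
def vline (t : ℝ) : Set ℂ := {z : ℂ | z.re = t}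

/-- The re-lettering of words that applies `τ` to the first letter. -/
def firstLetterPerm (τ : Equiv.Perm (Fin 4)) (j : ℕ) : Equiv.Perm (Fin j → Fin 4) :=
  Equiv.piCongrRight fun i => if (i : ℕ) = 0 then τ else Equiv.refl _

/-- The angle tree with root angle `ψ` and subtrees taken from `ω`, permuted by `τ`. -/
def reroot {n : ℕ} (τ : Equiv.Perm (Fin 4)) (ψ : ℝ) (ω : AngleTree n) : AngleTree n :=
  fun j u => if (j : ℕ) = 0 then ψ else ω j (firstLetterPerm τ j u)

instance isProbabilityMeasure_unif : IsProbabilityMeasure unif := by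
  constructor
  have h : ENNReal.ofReal (π / 2) ≠ 0 := by
    simpa using Real.pi_pos
  simp only [unif, Measure.smul_apply, Measure.restrict_apply_univ, Real.volume_Icc, sub_zero,
    smul_eq_mul]
  exact ENNReal.inv_mul_cancel h ENNReal.ofReal_ne_top

theorem measurePreserving_comp_perm {ι : Type*} [Fintype ι] (e : Equiv.Perm ι) (μ : Measure ℝ)
    [SigmaFinite μ] :
    MeasurePreserving (fun (a : ι → ℝ) i => a (e i)) (Measure.pi fun _ => μ)
      (Measure.pi fun _ => μ) := by
  convert measurePreserving_piCongrLeft (fun _ : ι => μ) e.symm using 1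
  ext a i
  simp [MeasurableEquiv.coe_piCongrLeft, Equiv.piCongrLeft_apply_eq_cast]

theorem measurePreserving_reroot (n : ℕ) (τ : Equiv.Perm (Fin 4)) (φ ψ : ℝ) :
    MeasurePreserving (reroot (n := n) τ ψ) (rootedTreeMeasure n φ) (rootedTreeMeasure n ψ) := by
  have hprob (x : ℝ) (j : Fin n) : IsProbabilityMeasure
      (if (j : ℕ) = 0 then Measure.dirac (fun _ : Fin j → Fin 4 => x)
        else Measure.pi fun _ : Fin j → Fin 4 => unif) := by
    split_ifs <;> infer_instance
  have hprob_φ := hprob φ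
  have hprob_ψ := hprob ψ
  unfold rootedTreeMeasure
  refine measurePreserving_pi
    (f := fun (j : Fin n) (a : (Fin j → Fin 4) → ℝ) u => if (j : ℕ) = 0 then ψ else a (firstLetterPerm τ j u)) _ _ fun j => ?_
  split_ifs with hj
  · exact ⟨measurable_const, by simp⟩
  · exact measurePreserving_comp_perm _ _

theorem vline_inter_closedBall_nonempty_iff {t r : ℝ} (c : ℂ) :
    (vline t ∩ Metric.closedBall c r).Nonempty ↔ |t - c.re| ≤ r := by
  constructor
  · rintro ⟨z, rfl, hz⟩
    rw [Metric.mem_closedBall, dist_eq_norm] at hz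
    exact (Complex.abs_re_le_norm (z - c)).trans hz
  · intro h
    refine ⟨⟨t, c.im⟩, rfl, ?_⟩
    rwa [Metric.mem_closedBall, Complex.dist_of_im_eq (by rfl), Real.dist_eq]

theorem vline_inter_TPart_nonempty_iff {k : ℕ} (t : ℝ) (α : Fin 4) (ω : AngleTree (k + 1)) :
    (vline t ∩ TPart α ω).Nonempty ↔
      ∃ w : Fin (k + 1) → Fin 4, w 0 = α ∧ |t - (center ω w).re| ≤ (4 : ℝ)⁻¹ ^ (k + 1) := by
  simp only [TPart, inter_iUnion, nonempty_iUnion, mem_ofPred_eq, exists_prop,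
    vline_inter_closedBall_nonempty_iff]

theorem center_re {n : ℕ} (ω : AngleTree n) (w : Fin n → Fin 4) :
    (center ω w).re = ∑ j : Fin n, 3 / 4 * (4 : ℝ)⁻¹ ^ (j : ℕ) *
      Real.cos (((w j : ℕ) : ℝ) * (π / 2) - ω j fun i => w (Fin.castLE j.isLt.le i)) := by
  rw [_root_.center, Complex.re_sum]
  refine Finset.sum_congr rfl fun j _ => ?_
  have h : (3 / 4 : ℂ) * (4 : ℂ)⁻¹ ^ (j : ℕ) = ((3 / 4 * (4 : ℝ)⁻¹ ^ (j : ℕ) : ℝ) : ℂ) := by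
    push_cast; rfl
  rw [h, Complex.re_ofReal_mul, Complex.exp_ofReal_mul_I_re]

theorem measurableSet_vline_inter_TPart_nonempty (k : ℕ) (t : ℝ) (α : Fin 4) :
    MeasurableSet {ω : AngleTree (k + 1) | (vline t ∩ TPart α ω).Nonempty} := by
  have hcenter (w : Fin (k + 1) → Fin 4) :
      Measurable fun ω : AngleTree (k + 1) => |t - (_root_.center ω w).re| := by
    simp only [center_re]
    fun_prop
  simp only [vline_inter_TPart_nonempty_iff, ofPred_exists]
  refine MeasurableSet.iUnion fun w => (MeasurableSet.const _).inter ?_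
  exact measurableSet_le (hcenter w) measurable_const

theorem center_reroot_re {k : ℕ} (τ : Equiv.Perm (Fin 4)) (ψ : ℝ) (ω : AngleTree (k + 1))
    (w : Fin (k + 1) → Fin 4) (hw : τ (w 0) = 0) :
    (center (reroot (.refl _) 0 ω) (firstLetterPerm τ _ w)).re =
      (center (reroot τ ψ ω) w).re +
        3 / 4 * (1 - Real.cos (((w 0 : ℕ) : ℝ) * (π / 2) - ψ)) := by
  rw [center_re, center_re, Fin.sum_univ_succ, Fin.sum_univ_succ]
  have h : ∀ j : Fin k, (firstLetterPerm τ _ w) j.succ = w j.succ := fun j => by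
    simp [firstLetterPerm]
  have h0 : (firstLetterPerm τ _ w) 0 = 0 := by
    simpa [firstLetterPerm] using hw
  have hrefl : ∀ j, firstLetterPerm (.refl _) j = .refl _ := fun j => by
    ext; simp [firstLetterPerm]
  have hrest : ∀ j : Fin k,
      reroot (.refl _) 0 ω j.succ
          (fun i => firstLetterPerm τ _ w (Fin.castLE j.succ.isLt.le i)) =
        reroot τ ψ ω j.succ (fun i => w (Fin.castLE j.succ.isLt.le i)) := fun j => by
    simp only [reroot, hrefl, Fin.val_succ, Nat.succ_ne_zero, if_false]
    rfl
  simp only [h, h0, hrest]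
  simp [reroot]
  ring

theorem rootedTreeMeasure_vline_inter_TPart (k : ℕ) (ψ t : ℝ) (τ : Equiv.Perm (Fin 4))
    (α : Fin 4) (hα : τ α = 0) :
    rootedTreeMeasure (k + 1) ψ {ω | (vline t ∩ TPart α ω).Nonempty} =
      rootedTreeMeasure (k + 1) 0
        {ω | (vline (t + 3 / 4 * (1 - Real.cos (((α : ℕ) : ℝ) * (π / 2) - ψ))) ∩
          TPart 0 ω).Nonempty} := by
  rw [← (measurePreserving_reroot (k + 1) τ 0 ψ).measure_preimage
      (measurableSet_vline_inter_TPart_nonempty k t α).nullMeasurableSet,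
    ← (measurePreserving_reroot (k + 1) (.refl _) 0 0).measure_preimage
      (measurableSet_vline_inter_TPart_nonempty k _ 0).nullMeasurableSet]
  congr 1
  ext ω
  simp only [mem_preimage, mem_ofPred_eq, vline_inter_TPart_nonempty_iff]
  refine (firstLetterPerm τ (k + 1)).exists_congr fun w => ?_
  have h0 : firstLetterPerm τ _ w 0 = 0 ↔ w 0 = α := by
    rw [← hα]
    simp [firstLetterPerm]
  rw [h0]
  refine and_congr_right fun hw => ?_
  rw [center_reroot_re τ ψ ω w (hw ▸ hα), hw, add_sub_add_right_eq_sub]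

/-- Shift lemma: with the root angle fixed to `ψ` and the remaining angles i.i.d. uniform
on `[0, π/2]`, the probability that the vertical line at `t` meets `𝒯_0^{(k+1)}` (resp.
`𝒯_1^{(k+1)}`) equals the probability, with root angle `0`, that the vertical line
shifted by `(3/4)(1 − cos ψ)` (resp. `(3/4)(1 − sin ψ)`) meets `𝒯_0^{(k+1)}`. -/
theorem rooted_shift_probability (k : ℕ) (hk : 1 ≤ k) (ψ : ℝ)
    (hψ : ψ ∈ Set.Icc 0 (π / 2)) (t : ℝ) :
    rootedTreeMeasure (k + 1) ψ {ω | (vline t ∩ TPart 0 ω).Nonempty} =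
        rootedTreeMeasure (k + 1) 0
          {ω | (vline (t + 3 / 4 * (1 - Real.cos ψ)) ∩ TPart 0 ω).Nonempty} ∧
      rootedTreeMeasure (k + 1) ψ {ω | (vline t ∩ TPart 1 ω).Nonempty} =
        rootedTreeMeasure (k + 1) 0
          {ω | (vline (t + 3 / 4 * (1 - Real.sin ψ)) ∩ TPart 0 ω).Nonempty} := by
  constructor
  · simpa using rootedTreeMeasure_vline_inter_TPart k ψ t (.refl _) 0 rfl
  · simpa [Real.cos_pi_div_two_sub] using
      rootedTreeMeasure_vline_inter_TPart k ψ t (.swap 0 1) 1 (Equiv.swap_apply_right 0 1)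

end
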